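/- arXiv:1701.01830 — 3 statements merged into one kernel-verified Lean document; each statement's English description precedes it below -/
import Mathlib

section
/- Let x⁺ be a minimizer over Q of the function x ↦ ⟨v, x − z⟩ + V_z(x), where z ∈ Q and v is a continuous linear functional on E. Then for every x ∈ Q one has 2 V_{x⁺}(x) ≤ 2 V_z(x) + 2⟨v, x − z⟩ + ‖v‖_*². -/
/-- First-order optimality: at a minimizer over a convex set, the derivative is nonnegative in
every feasible direction. -/
theorem IsMinOn.hasFDerivAt_sub_nonneg {E : Type*} [NormedAddCommGroup E] [NormedSpace ℝ E]
    {f : E → ℝ} {f' : E →L[ℝ] ℝ} {s : Set E} {a x : E} (hs : Convex ℝ s) (h : IsMinOn f s a)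
    (hf : HasFDerivAt f f' a) (ha : a ∈ s) (hx : x ∈ s) : 0 ≤ f' (x - a) :=
  h.localize.hasFDerivWithinAt_nonneg hf.hasFDerivWithinAt
    (sub_mem_posTangentConeAt_of_segment_subset (hs.segment_subset ha hx))

/-- Main property of a Mirror-Descent step: if `x⁺` minimizes
`x ↦ ⟨v, x − z⟩ + V_z(x)` over `Q`, then for all `x ∈ Q`,
`2 V_{x⁺}(x) ≤ 2 V_z(x) + 2⟨v, x − z⟩ + ‖v‖_*²`. -/
theorem smd_step_property
    {E : Type*} [NormedAddCommGroup E] [NormedSpace ℝ E] [FiniteDimensional ℝ E]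
    (Q : Set E) (hQne : Q.Nonempty) (hQcomp : IsCompact Q) (hQconv : Convex ℝ Q)
    (d : E → ℝ) (d' : E → E →L[ℝ] ℝ)
    (hd : ∀ x : E, HasFDerivAt d (d' x) x)
    (hd_strong : ∀ x ∈ Q, ∀ y ∈ Q,
      d x + d' x (y - x) + (1 / 2) * ‖y - x‖ ^ 2 ≤ d y)
    (V : E → E → ℝ)
    (hV : ∀ z x : E, V z x = d x - d z - d' z (x - z))
    (z : E) (hz : z ∈ Q) (v : E →L[ℝ] ℝ)
    (xplus : E) (hxplus : xplus ∈ Q)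
    (hmin : ∀ x ∈ Q, v (xplus - z) + V z xplus ≤ v (x - z) + V z x) :
    ∀ x ∈ Q, 2 * V xplus x ≤ 2 * V z x + 2 * v (x - z) + ‖v‖ ^ 2 := by
  intro x hx
  have hopt : 0 ≤ (v + d' xplus - d' z) (x - xplus) := by
    refine IsMinOn.hasFDerivAt_sub_nonneg (f := fun y => v y + d y - d' z y) hQconv ?_
      ((v.hasFDerivAt.add (hd xplus)).sub (d' z).hasFDerivAt) hxplus hx
    intro y hy
    have := hmin y hy
    simp only [hV, map_sub] at this
    simp only [Set.mem_ofPred_eq]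
    linarith
  have hstrong := hd_strong z hz xplus hxplus
  have hdual : -(‖v‖ * ‖xplus - z‖) ≤ v (xplus - z) :=
    (abs_le.mp (v.le_opNorm (xplus - z))).1
  have hsq := sq_nonneg (‖v‖ - ‖xplus - z‖)
  simp only [add_apply, sub_apply, map_sub] at hopt
  simp only [map_sub] at hstrong hdual
  simp only [hV, map_sub]
  linarith
end

section
/- Let f : E → ℝ be convex on Q, let x⁰, x¹, …, x^N be points of Q, let x* ∈ Q, let h > 0, M ≥ 0, and let δ₀, …, δ_{N−1} be real numbers such that for every k = 0, …, N−1: f(x^k) − f(x*) ≤ δ_k + (1/h)(V_{x^k}(x*) − V_{x^{k+1}}(x*)) + (h/2) M². Then the averaged point x̄^N = (1/N) Σ_{k=0}^{N−1} x^k satisfies f(x̄^N) − f(x*) ≤ (1/N) Σ_{k=0}^{N−1} δ_k + V_{x⁰}(x*)/(h N) + h M²/2. -/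
open Finset

/-- Telescoping/averaging step of the Mirror Descent analysis: if each step `k < N`
satisfies `f(x^k) − f(x*) ≤ δ_k + (1/h)(V_{x^k}(x*) − V_{x^{k+1}}(x*)) + (h/2)M²`,
then the averaged point `x̄^N = (1/N) Σ_{k<N} x^k` satisfies
`f(x̄^N) − f(x*) ≤ (1/N) Σ_{k<N} δ_k + V_{x⁰}(x*)/(hN) + hM²/2`. -/
theorem smd_averaging_bound
    {E : Type*} [NormedAddCommGroup E] [NormedSpace ℝ E] [FiniteDimensional ℝ E]
    (Q : Set E) (hQne : Q.Nonempty) (hQcomp : IsCompact Q) (hQconv : Convex ℝ Q)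
    (d : E → ℝ) (d' : E → E →L[ℝ] ℝ)
    (hd : ∀ x : E, HasFDerivAt d (d' x) x)
    (hd_strong : ∀ x ∈ Q, ∀ y ∈ Q,
      d x + d' x (y - x) + (1 / 2) * ‖y - x‖ ^ 2 ≤ d y)
    (V : E → E → ℝ)
    (hV : ∀ z x : E, V z x = d x - d z - d' z (x - z))
    (f : E → ℝ) (hf : ConvexOn ℝ Q f)
    (N : ℕ) (hN : 0 < N)
    (x : ℕ → E) (hxQ : ∀ k ≤ N, x k ∈ Q)
    (xstar : E) (hxstar : xstar ∈ Q)
    (h M : ℝ) (hh : 0 < h) (hM : 0 ≤ M)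
    (δ : ℕ → ℝ)
    (hstep : ∀ k < N, f (x k) - f xstar ≤
      δ k + (1 / h) * (V (x k) xstar - V (x (k + 1)) xstar) + (h / 2) * M ^ 2) :
    f ((N : ℝ)⁻¹ • ∑ k ∈ range N, x k) - f xstar ≤
      (N : ℝ)⁻¹ * ∑ k ∈ range N, δ k + V (x 0) xstar / (h * N) + h * M ^ 2 / 2 := by
  have hN' : (0 : ℝ) < N := Nat.cast_pos.mpr hN
  have hJensen : f ((N : ℝ)⁻¹ • ∑ k ∈ range N, x k) ≤ (N : ℝ)⁻¹ * ∑ k ∈ range N, f (x k) := by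
    rw [smul_sum, mul_sum]
    refine hf.map_sum_le (fun _ _ => by positivity) ?_
      (fun k hk => hxQ k (mem_range.mp hk).le)
    simp [hN'.ne']
  have hsum : ∑ k ∈ range N, f (x k) - N * f xstar ≤
      ∑ k ∈ range N, δ k + (1 / h) * (V (x 0) xstar - V (x N) xstar)
        + N * ((h / 2) * M ^ 2) := by
    have := sum_le_sum fun k hk => hstep k (mem_range.mp hk)
    rwa [sum_sub_distrib, sum_add_distrib, sum_add_distrib, ← mul_sum,
      sum_range_sub' (fun k => V (x k) xstar), sum_const, sum_const, card_range,
      nsmul_eq_mul, nsmul_eq_mul] at this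
  have hVnonneg : 0 ≤ V (x N) xstar := by
    rw [hV]
    linarith [hd_strong _ (hxQ N le_rfl) _ hxstar, sq_nonneg ‖xstar - x N‖]
  have hdrop : (1 / h) * (V (x 0) xstar - V (x N) xstar) ≤ (1 / h) * V (x 0) xstar := by
    gcongr
    linarith
  calc f ((N : ℝ)⁻¹ • ∑ k ∈ range N, x k) - f xstar
      ≤ (N : ℝ)⁻¹ * ∑ k ∈ range N, f (x k) - f xstar := by gcongr
    _ = (N : ℝ)⁻¹ * (∑ k ∈ range N, f (x k) - N * f xstar) := by field_simp
    _ ≤ (N : ℝ)⁻¹ * (∑ k ∈ range N, δ k + (1 / h) * V (x 0) xstar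
          + N * ((h / 2) * M ^ 2)) := by
        gcongr
        linarith
    _ = (N : ℝ)⁻¹ * ∑ k ∈ range N, δ k + V (x 0) xstar / (h * N) + h * M ^ 2 / 2 := by
        field_simp
end

section
/- (Abstract form of Corollary 1: a subgaussian tail implies Gaussian stochastic domination.) There exists an absolute constant C₀ ≥ 1 with the following property. Let ε > 0 and let Z be a real random variable on a probability space (Ω, P) such that for every σ ∈ (0,1): P{ Z ≥ (ε/C₀)(1 + √(ln(1/σ))) } ≤ σ. Then for every c ≥ ε one has P{ Z ≥ c } ≤ (gaussianReal ε ε²) {y : y ≥ c}. -/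
open MeasureTheory ProbabilityTheory
open scoped ENNReal

/-- A lower bound on the upper tail of a Gaussian with mean `ε` and standard deviation `ε`. -/
lemma ofReal_exp_le_gaussianReal_Ici {ε c : ℝ} (hε : 0 < ε) (hc : ε ≤ c) :
    ENNReal.ofReal (Real.exp (-((c / ε) ^ 2 / 2 + 2))) ≤
      gaussianReal ε (ε ^ 2).toNNReal {y | y ≥ c} := by
  have hv : (ε ^ 2).toNNReal ≠ 0 := by simpa using hε.ne'
  have hpdf : ∀ y ∈ Set.Icc c (c + ε),
      ENNReal.ofReal (Real.exp (-((c / ε) ^ 2 / 2 + 2)) / ε) ≤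
        gaussianPDF ε (ε ^ 2).toNNReal y := by
    rintro y ⟨hy₁, hy₂⟩
    apply ENNReal.ofReal_le_ofReal
    rw [gaussianPDFReal_def, Real.coe_toNNReal _ (sq_nonneg ε), neg_add, Real.exp_add,
      mul_div_assoc, mul_comm]
    refine mul_le_mul ?_ ?_ (Real.exp_pos _).le (by positivity)
    · rw [Real.exp_neg, div_eq_mul_inv, ← mul_inv]
      refine inv_anti₀ (by positivity) ((Real.sqrt_le_left (by positivity)).2 ?_)
      have he : (4 : ℝ) ≤ Real.exp 2 := by
        have h₁ := Real.add_one_le_exp (1 : ℝ)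
        have h₂ : Real.exp 2 = Real.exp 1 * Real.exp 1 := by rw [← Real.exp_add]; norm_num
        nlinarith
      rw [mul_pow]
      gcongr
      nlinarith [Real.pi_le_four]
    · have h : (y - ε) ^ 2 ≤ c ^ 2 := pow_le_pow_left₀ (by linarith) (by linarith) 2
      rw [Real.exp_le_exp, neg_div, neg_le_neg_iff, div_pow, div_div, mul_comm (2 : ℝ)]
      gcongr
  calc ENNReal.ofReal (Real.exp (-((c / ε) ^ 2 / 2 + 2)))
      = ENNReal.ofReal (Real.exp (-((c / ε) ^ 2 / 2 + 2)) / ε) *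
          volume (Set.Icc c (c + ε)) := by
        rw [Real.volume_Icc, ← ENNReal.ofReal_mul (by positivity)]
        congr 1
        field_simp
        ring
    _ ≤ ∫⁻ y in Set.Icc c (c + ε), gaussianPDF ε (ε ^ 2).toNNReal y := by
        rw [← setLIntegral_const]
        exact setLIntegral_mono (measurable_gaussianPDF _ _) hpdf
    _ = gaussianReal ε (ε ^ 2).toNNReal (Set.Icc c (c + ε)) := (gaussianReal_apply _ hv _).symm
    _ ≤ gaussianReal ε (ε ^ 2).toNNReal {y | y ≥ c} := measure_mono fun _ hy ↦ hy.1

/-- Abstract form of Corollary 1: there is an absolute constant `C₀ ≥ 1` such that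
any real random variable `Z` with the subgaussian-type tail
`P{ Z ≥ (ε/C₀)(1 + √(ln(1/σ))) } ≤ σ` for all `σ ∈ (0,1)` is stochastically
dominated, on `[ε, ∞)`, by a Gaussian with mean `ε` and variance `ε²`. -/
theorem subgaussian_tail_implies_gaussian_domination :
    ∃ C₀ : ℝ, 1 ≤ C₀ ∧
    ∀ (ε : ℝ), 0 < ε →
    ∀ (Ω : Type) (_ : MeasurableSpace Ω) (P : Measure Ω) (_ : IsProbabilityMeasure P)
      (Z : Ω → ℝ), Measurable Z →
      (∀ σ ∈ Set.Ioo (0 : ℝ) 1,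
        P {ω | Z ω ≥ (ε / C₀) * (1 + Real.sqrt (Real.log (1 / σ)))} ≤
          ENNReal.ofReal σ) →
      ∀ c : ℝ, ε ≤ c →
        P {ω | Z ω ≥ c} ≤ gaussianReal ε (ε ^ 2).toNNReal {y | y ≥ c} := by
  refine ⟨4, by norm_num, fun ε hε Ω _ P _ Z _ hZ c hc ↦ ?_⟩
  have hs : 1 ≤ c / ε := (one_le_div hε).2 hc
  have hσ : Real.exp (-(4 * (c / ε) - 1) ^ 2) ∈ Set.Ioo (0 : ℝ) 1 :=
    ⟨Real.exp_pos _, Real.exp_lt_one_iff.2 (by nlinarith)⟩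
  have hthreshold : ε / 4 * (1 + √(Real.log (1 / Real.exp (-(4 * (c / ε) - 1) ^ 2)))) = c := by
    rw [one_div, ← Real.exp_neg, neg_neg, Real.log_exp, Real.sqrt_sq (by linarith)]
    field_simp
    ring
  have htail := hZ _ hσ
  rw [hthreshold] at htail
  refine htail.trans (le_trans (ENNReal.ofReal_le_ofReal ?_)
    (ofReal_exp_le_gaussianReal_Ici hε hc))
  exact Real.exp_le_exp.2 (by nlinarith)
end
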